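/- Let ⟨τ_{a_1}⋯τ_{a_n}⟩_g be any family as in the context (symmetric, vanishing unless 2g−2+n > 0 and a_1+⋯+a_n = 3g−3+n); the DVV recursion is not assumed. Fix a stable (g,n), an index 1 ≤ i ≤ n, and w_0 > 0. Then for all w_1, …, w_n > 0: D_{w_0,w_i}[ x ↦ ω_{g,n}(x, w_{[n]∖{i}}) ] = 2^{n+1}·(w_1⋯w_n)^{3/2}·∂_{w_1}⋯∂_{w_n} G(w_1,…,w_n), where G(w_1,…,w_n) := 𝒟_{w_0,w_i}[ x ↦ ∂_xΩ_{g,n}(x, w_{[n]∖{i}}) ] (a function of (w_1,…,w_n), the variable w_i entering through the second subscript of 𝒟). -/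

import Mathlib

open Finset

/-- Real value of the double factorial `k‼` of an integer (with `k‼ = 1` for `k ≤ 0`,
in particular `(-1)‼ = 1`). -/
noncomputable def dfac (k : ℤ) : ℝ := (Nat.doubleFactorial k.toNat : ℝ)

/-- The polynomial (in one variable `x`) `ω_{g,m+1}(x, w_1, …, w_m)`. -/
noncomputable def omegaPoly (τ : ℤ → (n : ℕ) → (Fin n → ℤ) → ℝ) (g : ℤ) (m : ℕ)
    (w : Fin m → ℝ) : Polynomial ℝ :=
  ∑ a : Fin (m + 1) → Fin ((3 * g + (m + 1) - 3).toNat + 1),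
    Polynomial.C (τ g (m + 1) (fun i => ((a i : ℕ) : ℤ))
        * (∏ i, dfac (2 * ((a i : ℕ) : ℤ) + 1))
        * ∏ j : Fin m, w j ^ ((a j.succ : ℕ) + 1))
      * Polynomial.X ^ ((a 0 : ℕ) + 1)

/-- The linear operator `D_{u,v}` on polynomials in `x`, determined by
`D_{u,v} x^m = uv (u^m + 3u^{m-1}v + ⋯ + (2m+1)v^m)`. -/
noncomputable def Dop (u v : ℝ) (p : Polynomial ℝ) : ℝ :=
  ∑ m ∈ p.support, p.coeff m *
    (u * v * ∑ k ∈ Finset.range (m + 1), (2 * (k : ℝ) + 1) * u ^ (m - k) * v ^ k)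

/-- Removing the `i`-th entry from a tuple `(w_1, …, w_n)`. -/
def removeIdx {n : ℕ} (w : Fin n → ℝ) (i : Fin n) (j : Fin (n - 1)) : ℝ :=
  if (j : ℕ) < (i : ℕ) then w ⟨j, by have := j.2; omega⟩
  else w ⟨(j : ℕ) + 1, by have := j.2; omega⟩

/-- Formal representation of `∂ₓ Ω_{g,m+1}(x, w_1, …, w_m)` as an element of `ℝ[X]`,
where the monomial `X^a` stands for the half-integer power `x^{a-1/2}`. -/
noncomputable def dOmegaPoly (τ : ℤ → (n : ℕ) → (Fin n → ℤ) → ℝ) (g : ℤ) (m : ℕ)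
    (w : Fin m → ℝ) : Polynomial ℝ :=
  ∑ a : Fin (m + 1) → Fin ((3 * g + (m + 1) - 3).toNat + 1),
    Polynomial.C ((((a 0 : ℕ) : ℝ) + 1 / 2)
        * τ g (m + 1) (fun i => ((a i : ℕ) : ℤ))
        * (∏ i, dfac (2 * ((a i : ℕ) : ℤ) - 1))
        * ∏ j : Fin m, w j ^ (((a j.succ : ℕ) : ℝ) + 1 / 2))
      * Polynomial.X ^ (a 0 : ℕ)

/-- The linear operator `𝒟_{u,v}` on finite linear combinations of the functions
`x^{a-1/2}` (represented by polynomials via `X^a ↔ x^{a-1/2}`), determined by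
`𝒟_{u,v} x^{a-1/2} = u v^{1/2} (u^{a+1} + u^a v + ⋯ + v^{a+1})`. -/
noncomputable def Dcal (u v : ℝ) (p : Polynomial ℝ) : ℝ :=
  ∑ m ∈ p.support, p.coeff m *
    (u * v ^ ((1 : ℝ) / 2) * ∑ k ∈ Finset.range (m + 2), u ^ (m + 1 - k) * v ^ k)

/-- Partial derivative of a function of `n` real variables in the `i`-th slot. -/
noncomputable def pder {n : ℕ} (i : Fin n) (f : (Fin n → ℝ) → ℝ) : (Fin n → ℝ) → ℝ :=
  fun w => deriv (fun t => f (Function.update w i t)) (w i)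

/-- The iterated partial derivative `∂_{w_1} ∂_{w_2} ⋯ ∂_{w_n}`. -/
noncomputable def pderAll (n : ℕ) (f : (Fin n → ℝ) → ℝ) : (Fin n → ℝ) → ℝ :=
  (List.finRange n).foldr pder f

theorem dfac_two_mul_add_one (a : ℕ) :
    dfac (2 * (a : ℤ) + 1) = (2 * (a : ℝ) + 1) * dfac (2 * (a : ℤ) - 1) := by
  cases a with
  | zero => simp [dfac]
  | succ b =>
    have h₁ : (2 * ((b + 1 : ℕ) : ℤ) + 1).toNat = 2 * b + 1 + 2 := by omega
    have h₂ : (2 * ((b + 1 : ℕ) : ℤ) - 1).toNat = 2 * b + 1 := by omega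
    rw [dfac, dfac, h₁, h₂, Nat.doubleFactorial_add_two]
    push_cast
    ring

theorem Polynomial.sum_mul_sum_C_mul_X_pow {R ι : Type*} [CommSemiring R] (s : Finset ι)
    (c : ι → R) (e : ι → ℕ) (h : ℕ → R) :
    (∑ a ∈ s, Polynomial.C (c a) * Polynomial.X ^ e a).sum (fun m r => r * h m)
      = ∑ a ∈ s, c a * h (e a) := by
  classical
  induction s using Finset.induction_on with
  | empty => simp
  | insert a s ha ih =>
    rw [Finset.sum_insert ha, Finset.sum_insert ha,
      Polynomial.sum_add_index _ _ _ (by simp) (by intros; ring), ih,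
      Polynomial.C_mul_X_pow_eq_monomial, Polynomial.sum_monomial_index _ _ (by simp)]

theorem Dop_sum_C_mul_X_pow {ι : Type*} (u v : ℝ) (s : Finset ι) (c : ι → ℝ) (e : ι → ℕ) :
    Dop u v (∑ a ∈ s, Polynomial.C (c a) * Polynomial.X ^ e a)
      = ∑ a ∈ s, c a * (u * v * ∑ k ∈ Finset.range (e a + 1),
          (2 * (k : ℝ) + 1) * u ^ (e a - k) * v ^ k) :=
  Polynomial.sum_mul_sum_C_mul_X_pow s c e fun m =>
    u * v * ∑ k ∈ Finset.range (m + 1), (2 * (k : ℝ) + 1) * u ^ (m - k) * v ^ k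

theorem Dcal_sum_C_mul_X_pow {ι : Type*} (u v : ℝ) (s : Finset ι) (c : ι → ℝ) (e : ι → ℕ) :
    Dcal u v (∑ a ∈ s, Polynomial.C (c a) * Polynomial.X ^ e a)
      = ∑ a ∈ s, c a * (u * v ^ ((1 : ℝ) / 2) * ∑ k ∈ Finset.range (e a + 2),
          u ^ (e a + 1 - k) * v ^ k) :=
  Polynomial.sum_mul_sum_C_mul_X_pow s c e fun m =>
    u * v ^ ((1 : ℝ) / 2) * ∑ k ∈ Finset.range (m + 2), u ^ (m + 1 - k) * v ^ k

theorem removeIdx_eq_succAbove {m : ℕ} (w : Fin (m + 1) → ℝ) (i : Fin (m + 1)) (j : Fin m) :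
    removeIdx w i j = w (i.succAbove j) := by
  unfold removeIdx Fin.succAbove
  simp only [Fin.lt_def, Fin.val_castSucc]
  split_ifs <;> rfl

/-- On the positive orthant, iterated partial derivatives of a finite sum of products of
one-variable functions are computed factor by factor. -/
theorem foldr_pder_sum_prod {n : ℕ} {ι : Type*} (s : Finset ι) (c : ι → ℝ)
    (φ φ' : ι → Fin n → ℝ → ℝ)
    (hφ : ∀ a j x, 0 < x → HasDerivAt (φ a j) (φ' a j x) x)
    (f : (Fin n → ℝ) → ℝ)
    (hf : ∀ v, (∀ j, 0 < v j) → f v = ∑ a ∈ s, c a * ∏ j, φ a j (v j))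
    (l : List (Fin n)) (hl : l.Nodup) (w : Fin n → ℝ) (hw : ∀ j, 0 < w j) :
    l.foldr pder f w
      = ∑ a ∈ s, c a * ∏ j, (if j ∈ l then φ' a j (w j) else φ a j (w j)) := by
  induction l generalizing w with
  | nil => simpa using hf w hw
  | cons i l ih =>
    obtain ⟨hil, hl⟩ := List.nodup_cons.1 hl
    rw [List.foldr_cons]
    have hev : (fun t => l.foldr pder f (Function.update w i t)) =ᶠ[nhds (w i)]
        fun t => ∑ a ∈ s, c a * (φ a i t * ∏ j ∈ Finset.univ.erase i,
          (if j ∈ l then φ' a j (w j) else φ a j (w j))) := by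
      filter_upwards [lt_mem_nhds (hw i)] with t ht
      rw [ih hl _ fun j => by
        rcases eq_or_ne j i with rfl | h
        · simpa using ht
        · simpa [h] using hw j]
      refine Finset.sum_congr rfl fun a _ => ?_
      rw [← Finset.mul_prod_erase _ _ (Finset.mem_univ i)]
      simp only [if_neg hil, Function.update_self]
      congr 2
      refine Finset.prod_congr rfl fun j hj => ?_
      rw [Function.update_of_ne (Finset.ne_of_mem_erase hj)]
    have hd : HasDerivAt (fun t => ∑ a ∈ s, c a * (φ a i t * ∏ j ∈ Finset.univ.erase i,
          (if j ∈ l then φ' a j (w j) else φ a j (w j))))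
        (∑ a ∈ s, c a * (φ' a i (w i) * ∏ j ∈ Finset.univ.erase i,
          (if j ∈ l then φ' a j (w j) else φ a j (w j)))) (w i) :=
      HasDerivAt.fun_sum fun a _ => ((hφ a i _ (hw i)).mul_const _).const_mul _
    rw [pder, hev.deriv_eq, hd.deriv]
    refine Finset.sum_congr rfl fun a _ => ?_
    rw [← Finset.mul_prod_erase _ _ (Finset.mem_univ i)]
    simp only [List.mem_cons, true_or, if_true]
    congr 2
    refine Finset.prod_congr rfl fun j hj => ?_
    simp [Finset.ne_of_mem_erase hj]

theorem pderAll_sum_prod_rpow {n : ℕ} {ι : Type*} (s : Finset ι) (c : ι → ℝ)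
    (p : ι → Fin n → ℝ) (f : (Fin n → ℝ) → ℝ)
    (hf : ∀ v, (∀ j, 0 < v j) → f v = ∑ a ∈ s, c a * ∏ j, v j ^ p a j)
    (w : Fin n → ℝ) (hw : ∀ j, 0 < w j) :
    pderAll n f w = ∑ a ∈ s, c a * ∏ j, (p a j * w j ^ (p a j - 1)) := by
  rw [pderAll, foldr_pder_sum_prod s c (fun a j x => x ^ p a j)
    (fun a j x => p a j * x ^ (p a j - 1))
    (fun a j x hx => Real.hasDerivAt_rpow_const (Or.inl hx.ne')) f hf _
    (List.nodup_finRange n) w hw]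
  simp

theorem rpow_three_half_mul_two_mul_deriv {x : ℝ} (hx : 0 < x) (a : ℕ) :
    x ^ ((3 : ℝ) / 2) * (2 * (((a : ℝ) + 1 / 2) * x ^ ((a : ℝ) + 1 / 2 - 1)))
      = (2 * (a : ℝ) + 1) * x ^ (a + 1) := by
  have h : x ^ ((3 : ℝ) / 2) * x ^ ((a : ℝ) + 1 / 2 - 1) = x ^ (a + 1) := by
    rw [← Real.rpow_add hx, ← Real.rpow_natCast]
    congr 1
    push_cast
    ring
  rw [← h]
  ring

/-- Lemma 4.2 of the paper: for stable `(g,n)`, an index `i` and `w_0 > 0`,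
`D_{w_0,w_i} ω_{g,n}(x, w_{[n]∖{i}})
  = 2^{n+1} (w_1⋯w_n)^{3/2} ∂_{w_1}⋯∂_{w_n} 𝒟_{w_0,w_i}[∂ₓ Ω_{g,n}(x, w_{[n]∖{i}})]`. -/
theorem D_omega_eq_derivative_of_Dcal_Omega (τ : ℤ → (n : ℕ) → (Fin n → ℤ) → ℝ)
    (hsymm : ∀ (g : ℤ) (n : ℕ) (a : Fin n → ℤ) (σ : Equiv.Perm (Fin n)),
      τ g n (a ∘ σ) = τ g n a)
    (hvanish : ∀ (g : ℤ) (n : ℕ) (a : Fin n → ℤ),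
      ¬((∀ i, 0 ≤ a i) ∧ 0 < 2 * g - 2 + (n : ℤ) ∧ (∑ i, a i) = 3 * g - 3 + n) → τ g n a = 0)
    (g n : ℕ) (hstab : 3 ≤ 2 * g + n) (i : Fin n) (w₀ : ℝ) (hw₀ : 0 < w₀)
    (w : Fin n → ℝ) (hw : ∀ j, 0 < w j) :
    Dop w₀ (w i) (omegaPoly τ g (n - 1) (removeIdx w i))
      = 2 ^ (n + 1) * (∏ j, w j ^ ((3 : ℝ) / 2)) *
          pderAll n (fun v => Dcal w₀ (v i) (dOmegaPoly τ g (n - 1) (removeIdx v i))) w := by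
  obtain _ | m := n
  · exact i.elim0
  change Dop w₀ (w i) (omegaPoly τ g m (removeIdx w i))
    = 2 ^ (m + 1 + 1) * (∏ j, w j ^ ((3 : ℝ) / 2)) *
      pderAll (m + 1) (fun v => Dcal w₀ (v i) (dOmegaPoly τ g m (removeIdx v i))) w
  have hrem : ∀ v : Fin (m + 1) → ℝ,
      removeIdx v i = fun j => v (i.succAbove j) := fun v =>
    funext fun j => removeIdx_eq_succAbove v i j
  set N := (3 * (g : ℤ) + ((m : ℤ) + 1) - 3).toNat + 1
  set S : Finset (Σ _ : Fin (m + 1) → Fin N, ℕ) :=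
    Finset.univ.sigma fun a => Finset.range ((a 0 : ℕ) + 2)
  rw [pderAll_sum_prod_rpow S
    (fun s => (((s.1 0 : ℕ) : ℝ) + 1 / 2) * τ g (m + 1) (fun i => ((s.1 i : ℕ) : ℤ))
        * (∏ i, dfac (2 * ((s.1 i : ℕ) : ℤ) - 1)) * w₀ * w₀ ^ ((s.1 0 : ℕ) + 1 - s.2))
    (fun s => i.insertNth (α := fun _ => ℝ) ((s.2 : ℝ) + 1 / 2)
      fun j => ((s.1 j.succ : ℕ) : ℝ) + 1 / 2) _ ?_ w hw]
  · rw [hrem, omegaPoly, Dop_sum_C_mul_X_pow, Finset.sum_sigma, Finset.mul_sum]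
    refine Finset.sum_congr rfl fun a _ => ?_
    rw [Finset.mul_sum, Finset.mul_sum, Finset.mul_sum]
    refine Finset.sum_congr rfl fun k _ => ?_
    have hprod : (2 : ℝ) ^ (m + 1) * (∏ j, w j ^ ((3 : ℝ) / 2)) *
        ∏ j, ((i.insertNth (α := fun _ => ℝ) ((k : ℝ) + 1 / 2)
            fun j => ((a j.succ : ℕ) : ℝ) + 1 / 2 : Fin (m + 1) → ℝ) j *
          w j ^ ((i.insertNth (α := fun _ => ℝ) ((k : ℝ) + 1 / 2)
            fun j => ((a j.succ : ℕ) : ℝ) + 1 / 2 : Fin (m + 1) → ℝ) j - 1))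
        = (2 * (k : ℝ) + 1) * w i ^ (k + 1) * ((∏ j : Fin m, (2 * ((a j.succ : ℕ) : ℝ) + 1)) *
          ∏ j : Fin m, w (i.succAbove j) ^ ((a j.succ : ℕ) + 1)) := by
      have h2 : (2 : ℝ) ^ (m + 1) = ∏ _j : Fin (m + 1), (2 : ℝ) := by simp
      rw [h2, ← Finset.prod_mul_distrib, ← Finset.prod_mul_distrib, ← Finset.prod_mul_distrib,
        Fin.prod_univ_succAbove _ i]
      simp only [Fin.insertNth_apply_same, Fin.insertNth_apply_succAbove]
      congr 1
      · rw [← rpow_three_half_mul_two_mul_deriv (hw i)]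
        ring
      · refine Finset.prod_congr rfl fun j _ => ?_
        rw [← rpow_three_half_mul_two_mul_deriv (hw _)]
        ring
    have hdfac : ∏ i, dfac (2 * ((a i : ℕ) : ℤ) + 1)
        = (2 * ((a 0 : ℕ) : ℝ) + 1) * (∏ j : Fin m, (2 * ((a j.succ : ℕ) : ℝ) + 1)) *
          ∏ i, dfac (2 * ((a i : ℕ) : ℤ) - 1) := by
      simp only [dfac_two_mul_add_one, Finset.prod_mul_distrib]
      rw [Fin.prod_univ_succ fun i => 2 * ((a i : ℕ) : ℝ) + 1]
    rw [hdfac]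
    trans 2 * ((((a 0 : ℕ) : ℝ) + 1 / 2) * τ g (m + 1) (fun i => ((a i : ℕ) : ℤ))
        * (∏ i, dfac (2 * ((a i : ℕ) : ℤ) - 1)) * w₀ * w₀ ^ ((a 0 : ℕ) + 1 - k)) *
        ((2 * (k : ℝ) + 1) * w i ^ (k + 1) * ((∏ j : Fin m, (2 * ((a j.succ : ℕ) : ℝ) + 1)) *
          ∏ j : Fin m, w (i.succAbove j) ^ ((a j.succ : ℕ) + 1)))
    · ring
    · rw [← hprod]
      ring
  · intro v hv
    rw [hrem, dOmegaPoly, Dcal_sum_C_mul_X_pow, Finset.sum_sigma]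
    refine Finset.sum_congr rfl fun a _ => ?_
    rw [Finset.mul_sum, Finset.mul_sum]
    refine Finset.sum_congr rfl fun k _ => ?_
    rw [Fin.prod_univ_succAbove (fun j => v j ^ (i.insertNth (α := fun _ => ℝ) ((k : ℝ) + 1 / 2)
      fun j => ((a j.succ : ℕ) : ℝ) + 1 / 2 : Fin (m + 1) → ℝ) j) i]
    simp only [Fin.insertNth_apply_same, Fin.insertNth_apply_succAbove]
    rw [Real.rpow_add (hv i), Real.rpow_natCast]
    ring
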